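/- arXiv:2406.08998 — 3 statements merged into one kernel-verified Lean document; each statement's English description precedes it below -/
import Mathlib

section
/- Let P be a Pauli-type basis of the d×d complex matrices (d = 2^n) with each P i Hermitian, and let U be a unitary d×d matrix. Then distinct rows of the encoded matrix f(U) are orthogonal: for all indices i ≠ k, Σ_j f(U) i j · conj(f(U) k j) = 0. -/
open Matrix

/-- The encoded matrix `f(U)` of a unitary `U` with respect to the family `P`,
with entries `f(U) i j = (1/d) * trace (P j * Uᴴ * P i * U)`. -/
noncomputable def encodedMatrix {n : ℕ} {ι : Type*} [Fintype ι]
    (P : ι → Matrix (Fin (2 ^ n)) (Fin (2 ^ n)) ℂ)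
    (U : Matrix (Fin (2 ^ n)) (Fin (2 ^ n)) ℂ) : Matrix ι ι ℂ :=
  Matrix.of fun i j => (1 / ((2 ^ n : ℕ) : ℂ)) * Matrix.trace (P j * Uᴴ * P i * U)

/-- Distinct rows of the encoded matrix `f(U)` are orthogonal. -/
theorem encodedMatrix_rows_orthogonal {n : ℕ} {ι : Type*} [Fintype ι] [DecidableEq ι]
    (P : ι → Matrix (Fin (2 ^ n)) (Fin (2 ^ n)) ℂ)
    (hcard : Fintype.card ι = (2 ^ n) ^ 2)
    (hli : LinearIndependent ℂ P)
    (hspan : ⊤ ≤ Submodule.span ℂ (Set.range P))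
    (horth : ∀ i j, Matrix.trace (P i * P j) = if i = j then ((2 ^ n : ℕ) : ℂ) else 0)
    (hherm : ∀ i, (P i)ᴴ = P i)
    (U : Matrix (Fin (2 ^ n)) (Fin (2 ^ n)) ℂ)
    (hU : U ∈ Matrix.unitaryGroup (Fin (2 ^ n)) ℂ) :
    ∀ i k, i ≠ k →
      ∑ j, encodedMatrix P U i j * (starRingEnd ℂ) (encodedMatrix P U k j) = 0 := by
  intro i k hik
  have hd : ((2 ^ n : ℕ) : ℂ) ≠ 0 := by simp
  have hUU : U * Uᴴ = 1 := (Matrix.mem_unitaryGroup_iff).1 hU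
  obtain ⟨c, hc⟩ := (Submodule.mem_span_range_iff_exists_fun ℂ).1
    (hspan (Submodule.mem_top (x := Uᴴ * P k * U)))
  have hf : ∀ i j, encodedMatrix P U i j
      = (1 / ((2 ^ n : ℕ) : ℂ)) * Matrix.trace (P j * (Uᴴ * P i * U)) := by
    intro i j
    simp only [encodedMatrix, Matrix.of_apply, Matrix.mul_assoc]
  have hconj : ∀ j, (starRingEnd ℂ) (encodedMatrix P U k j) = encodedMatrix P U k j := by
    intro j
    rw [hf, map_mul, starRingEnd_apply (Matrix.trace _), ← Matrix.trace_conjTranspose,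
      Matrix.conjTranspose_mul, hherm, Matrix.conjTranspose_mul, Matrix.conjTranspose_mul,
      hherm, Matrix.conjTranspose_conjTranspose, Matrix.trace_mul_comm, ← Matrix.mul_assoc Uᴴ,
      map_div₀, map_one, map_natCast]
  have hcj : ∀ j, encodedMatrix P U k j = c j := by
    intro j
    rw [hf, ← hc, Matrix.mul_sum, Matrix.trace_sum]
    simp only [Matrix.mul_smul, Matrix.trace_smul, horth, smul_eq_mul, mul_ite, mul_zero,
      Finset.sum_ite_eq, Finset.mem_univ, if_true]
    field_simp
  have key : ∑ j, encodedMatrix P U i j * (starRingEnd ℂ) (encodedMatrix P U k j)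
      = (1 / ((2 ^ n : ℕ) : ℂ)) * Matrix.trace ((Uᴴ * P k * U) * (Uᴴ * P i * U)) := by
    rw [← hc, Matrix.sum_mul, Matrix.trace_sum, Finset.mul_sum]
    refine Finset.sum_congr rfl fun j _ => ?_
    rw [hconj, hcj, hf, Matrix.smul_mul, Matrix.trace_smul, smul_eq_mul]
    ring
  have htr : Matrix.trace ((Uᴴ * P k * U) * (Uᴴ * P i * U)) = Matrix.trace (P k * P i) := by
    have h1 : (Uᴴ * P k * U) * (Uᴴ * P i * U) = Uᴴ * (P k * (U * Uᴴ) * P i * U) := by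
      simp only [Matrix.mul_assoc]
    rw [h1, hUU, Matrix.mul_one, Matrix.trace_mul_comm, Matrix.mul_assoc, hUU, Matrix.mul_one]
  rw [key, htr, horth, if_neg (Ne.symm hik), mul_zero]
end

section
/- Let P be a Pauli-type basis of the d×d complex matrices (d = 2^n) with each P i Hermitian, and let U be a unitary d×d matrix. Then the encoded matrix f(U) is itself a unitary matrix: f(U) * (f(U))ᴴ = 1 and (f(U))ᴴ * f(U) = 1, i.e. f(U) ∈ Matrix.unitaryGroup ι ℂ. -/
open Matrix

/-- The encoded matrix `f(U)` of a unitary `U` is itself unitary: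
`f(U) * f(U)ᴴ = 1`, `f(U)ᴴ * f(U) = 1`, i.e., `f(U) ∈ Matrix.unitaryGroup ι ℂ`. -/
theorem encodedMatrix_unitary {n : ℕ} {ι : Type*} [Fintype ι] [DecidableEq ι]
    (P : ι → Matrix (Fin (2 ^ n)) (Fin (2 ^ n)) ℂ)
    (hcard : Fintype.card ι = (2 ^ n) ^ 2)
    (hli : LinearIndependent ℂ P)
    (hspan : ⊤ ≤ Submodule.span ℂ (Set.range P))
    (horth : ∀ i j, Matrix.trace (P i * P j) = if i = j then ((2 ^ n : ℕ) : ℂ) else 0)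
    (hherm : ∀ i, (P i)ᴴ = P i)
    (U : Matrix (Fin (2 ^ n)) (Fin (2 ^ n)) ℂ)
    (hU : U ∈ Matrix.unitaryGroup (Fin (2 ^ n)) ℂ) :
    encodedMatrix P U * (encodedMatrix P U)ᴴ = 1 ∧
      (encodedMatrix P U)ᴴ * encodedMatrix P U = 1 ∧
      encodedMatrix P U ∈ Matrix.unitaryGroup ι ℂ := by
  have hd : ((2 ^ n : ℕ) : ℂ) ≠ 0 := Nat.cast_ne_zero.mpr (by positivity)
  have hUU : U * Uᴴ = 1 := Matrix.mem_unitaryGroup_iff.mp hU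
  have hexp : ∀ A : Matrix (Fin (2 ^ n)) (Fin (2 ^ n)) ℂ,
      ∑ j, ((1 / ((2 ^ n : ℕ) : ℂ)) * Matrix.trace (P j * A)) • P j = A := by
    intro A
    have hA : A ∈ Submodule.span ℂ (Set.range P) := hspan Submodule.mem_top
    induction hA using Submodule.span_induction with
    | mem x hx =>
      obtain ⟨i, rfl⟩ := hx
      rw [Finset.sum_eq_single i]
      · rw [horth, if_pos rfl, one_div, inv_mul_cancel₀ hd, one_smul]
      · intro j _ hj
        rw [horth, if_neg hj, mul_zero, zero_smul]
      · intro h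
        exact absurd (Finset.mem_univ i) h
    | zero => simp
    | add x y _ _ hx hy =>
      simp only [Matrix.trace_add, mul_add, add_smul, Finset.sum_add_distrib]
      rw [hx, hy]
    | smul a x _ hx =>
      conv_rhs => rw [← hx]
      rw [Finset.smul_sum]
      refine Finset.sum_congr rfl fun j _ => ?_
      rw [Matrix.mul_smul, Matrix.trace_smul, smul_smul, smul_eq_mul]
      congr 1
      ring
  have hstar : ∀ k j, star (encodedMatrix P U k j) = encodedMatrix P U k j := by
    intro k j
    simp only [encodedMatrix, Matrix.of_apply, star_mul']
    rw [← Matrix.trace_conjTranspose]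
    simp only [Matrix.conjTranspose_mul, Matrix.conjTranspose_conjTranspose, hherm]
    congr 1
    · simp
    · rw [← Matrix.mul_assoc, ← Matrix.mul_assoc, Matrix.trace_mul_comm]
      simp only [Matrix.mul_assoc]
  have h1 : encodedMatrix P U * (encodedMatrix P U)ᴴ = 1 := by
    ext i k
    rw [Matrix.mul_apply]
    simp only [Matrix.conjTranspose_apply, hstar]
    have key := congrArg (fun B => (1 / ((2 ^ n : ℕ) : ℂ)) * Matrix.trace (B * (Uᴴ * P k * U)))
      (hexp (Uᴴ * P i * U))
    simp only [Finset.sum_mul, Matrix.trace_sum, Matrix.smul_mul, Matrix.trace_smul,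
      Finset.mul_sum, smul_eq_mul] at key
    have e : Matrix.trace (Uᴴ * P i * U * (Uᴴ * P k * U)) = Matrix.trace (P i * P k) := by
      have : Uᴴ * P i * U * (Uᴴ * P k * U) = Uᴴ * (P i * (U * Uᴴ) * P k * U) := by
        simp only [Matrix.mul_assoc]
      rw [this, hUU, Matrix.mul_one, Matrix.trace_mul_comm, Matrix.mul_assoc, hUU, Matrix.mul_one]
    rw [e, horth] at key
    have hr : (1 / ((2 ^ n : ℕ) : ℂ)) * (if i = k then ((2 ^ n : ℕ) : ℂ) else 0)
        = (1 : Matrix ι ι ℂ) i k := by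
      rw [Matrix.one_apply]
      split_ifs
      · rw [one_div, inv_mul_cancel₀ hd]
      · rw [mul_zero]
    rw [← hr, ← key]
    refine Finset.sum_congr rfl fun j _ => ?_
    simp only [encodedMatrix, Matrix.of_apply, Matrix.mul_assoc]
    ring
  exact ⟨h1, mul_eq_one_comm.mp h1, Matrix.mem_unitaryGroup_iff.mpr h1⟩
end

section
/- Let ι be a finite type, v : ι → ℝ with v i ≥ 0 for all i, ε > 0, and n : ι → ℝ with n i > 0 for all i. If Σ_i v i / n i ≤ ε², then the total number of measurements satisfies the lower bound Σ_i n i ≥ (Σ_i sqrt(v i))² / ε². -/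
/-- Cauchy–Schwarz lower bound on the total number of measurements:
if the allocation `n` meets the error budget `Σ_i v i / n i ≤ ε²`, then
`Σ_i n i ≥ (Σ_i sqrt (v i))² / ε²`. -/
theorem measurement_count_lower_bound {ι : Type*} [Fintype ι]
    (v n : ι → ℝ) (ε : ℝ)
    (hv : ∀ i, 0 ≤ v i) (hn : ∀ i, 0 < n i) (hε : 0 < ε)
    (hbudget : ∑ i, v i / n i ≤ ε ^ 2) :
    (∑ i, Real.sqrt (v i)) ^ 2 / ε ^ 2 ≤ ∑ i, n i := by
  rw [div_le_iff₀ (by positivity)]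
  have h := Finset.sum_sq_le_sum_mul_sum_of_sq_eq_mul Finset.univ
    (r := fun i => Real.sqrt (v i)) (f := n) (g := fun i => v i / n i)
    (fun i _ => (hn i).le) (fun i _ => div_nonneg (hv i) (hn i).le)
    (fun i _ => by
      have := (hn i).ne'
      rw [Real.sq_sqrt (hv i)]
      field_simp)
  exact h.trans (mul_le_mul_of_nonneg_left hbudget (Finset.sum_nonneg fun i _ => (hn i).le))
end
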